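/- Let (1/N)·rank(Y_N − Y_N') → 0 in probability as N → ∞, where Y_N, Y_N' are N×N random Hermitian matrices, and let W_N be N×N random Hermitian matrices. Then for any fixed non-commutative polynomial p with complex coefficients, lim_{N→∞} E[(1/N)·rank(p(W_N, Y_N) − p(W_N, Y_N'))] = 0, and consequently the Kolmogorov distance between EESD(p(W_N,Y_N)) and EESD(p(W_N,Y_N')) tends to 0, provided both polynomial evaluations are Hermitian. -/

import Mathlib

open MeasureTheory Matrix

/-- Evaluation of a non-commutative polynomial in two variables at a pair of
square matrices. -/
noncomputable def ncEval {N : ℕ} (p : FreeAlgebra ℂ (Fin 2))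
    (A B : Matrix (Fin N) (Fin N) ℂ) : Matrix (Fin N) (Fin N) ℂ :=
  FreeAlgebra.lift ℂ (![A, B]) p

theorem inner_apply_self_eq_sum {E : Type*} [NormedAddCommGroup E] [InnerProductSpace ℂ E]
    [FiniteDimensional ℂ E] {n : ℕ} (hn : Module.finrank ℂ E = n) {T : E →ₗ[ℂ] E}
    (hT : T.IsSymmetric) (v : E) :
    RCLike.re (inner ℂ v (T v)) =
      ∑ i, hT.eigenvalues hn i * ‖inner ℂ (hT.eigenvectorBasis hn i) v‖ ^ 2 := by
  rw [← (hT.eigenvectorBasis hn).sum_inner_mul_inner v (T v), map_sum]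
  refine Finset.sum_congr rfl fun i _ => ?_
  rw [← hT, hT.apply_eigenvectorBasis, inner_smul_left, ← inner_conj_symm v, RCLike.conj_ofReal,
    mul_left_comm, RCLike.conj_mul, ← RCLike.ofReal_pow, ← RCLike.ofReal_mul, RCLike.ofReal_re]

theorem inner_eq_zero_of_mem_span_image {ι E : Type*} [NormedAddCommGroup E]
    [InnerProductSpace ℂ E] [Fintype ι] (b : OrthonormalBasis ι ℂ E) {s : Set ι} {v : E}
    (hv : v ∈ Submodule.span ℂ (b '' s)) {i : ι} (hi : i ∉ s) : inner ℂ (b i) v = 0 := by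
  rw [← b.coe_toBasis, Module.Basis.mem_span_image] at hv
  have h : i ∉ (b.toBasis.repr v).support := fun h => hi (hv h)
  rw [← b.repr_apply_apply]
  simpa using h

theorem finrank_span_image_orthonormalBasis {ι E : Type*} [NormedAddCommGroup E]
    [InnerProductSpace ℂ E] [Fintype ι] (b : OrthonormalBasis ι ℂ E) (s : Finset ι) :
    Module.finrank ℂ (Submodule.span ℂ (b '' s)) = s.card := by
  have h := b.orthonormal.linearIndependent.comp ((↑) : s → ι) Subtype.val_injective
  have hs : b '' s = Set.range (b ∘ ((↑) : s → ι)) := by simp [Set.range_comp]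
  rw [hs, finrank_span_eq_card h, Fintype.card_coe]

theorem exists_ne_zero_mem_inf_inf {K V : Type*} [DivisionRing K] [AddCommGroup V] [Module K V]
    [FiniteDimensional K V] (U₁ U₂ U₃ : Submodule K V)
    (h : 2 * Module.finrank K V <
      Module.finrank K U₁ + Module.finrank K U₂ + Module.finrank K U₃) :
    ∃ v, v ≠ 0 ∧ v ∈ U₁ ∧ v ∈ U₂ ∧ v ∈ U₃ := by
  have h₁ := Submodule.finrank_sup_add_finrank_inf_eq U₁ U₂
  have h₂ := Submodule.finrank_sup_add_finrank_inf_eq (U₁ ⊓ U₂) U₃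
  have h₃ := Submodule.finrank_le (U₁ ⊔ U₂)
  have h₄ := Submodule.finrank_le (U₁ ⊓ U₂ ⊔ U₃)
  have hpos : 0 < Module.finrank K ↥(U₁ ⊓ U₂ ⊓ U₃) := by omega
  obtain ⟨v, hv, hv0⟩ := Submodule.exists_mem_ne_zero_of_ne_bot
    (Submodule.one_le_finrank_iff.mp hpos)
  exact ⟨v, hv0, hv.1.1, hv.1.2, hv.2⟩

theorem LinearMap.IsSymmetric.eigenvalues_le_of_finrank_range_sub {E : Type*}
    [NormedAddCommGroup E] [InnerProductSpace ℂ E] [FiniteDimensional ℂ E] {n : ℕ}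
    (hn : Module.finrank ℂ E = n) {S T : E →ₗ[ℂ] E} (hS : S.IsSymmetric) (hT : T.IsSymmetric)
    {i j : Fin n} (hij : i + Module.finrank ℂ (LinearMap.range (S - T)) ≤ j) :
    hS.eigenvalues hn j ≤ hT.eigenvalues hn i := by
  obtain ⟨v, hv0, hvS, hvT, hv⟩ := exists_ne_zero_mem_inf_inf
    (Submodule.span ℂ (hS.eigenvectorBasis hn '' (Finset.Iic j : Finset (Fin n))))
    (Submodule.span ℂ (hT.eigenvectorBasis hn '' (Finset.Ici i : Finset (Fin n))))
    (LinearMap.ker (S - T)) (by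
      have := LinearMap.finrank_range_add_finrank_ker (S - T)
      rw [finrank_span_image_orthonormalBasis, finrank_span_image_orthonormalBasis,
        Fin.card_Iic, Fin.card_Ici]
      omega)
  have hST : S v = T v := by simpa [sub_eq_zero] using hv
  have hlow : hS.eigenvalues hn j * ‖v‖ ^ 2 ≤ RCLike.re (inner ℂ v (S v)) := by
    rw [inner_apply_self_eq_sum hn hS, ← (hS.eigenvectorBasis hn).sum_sq_norm_inner_right,
      Finset.mul_sum]
    refine Finset.sum_le_sum fun k _ => ?_
    by_cases hk : k ≤ j
    · exact mul_le_mul_of_nonneg_right (hS.eigenvalues_antitone hn hk) (by positivity)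
    · simp [inner_eq_zero_of_mem_span_image _ hvS (i := k) (by simpa using hk)]
  have hupp : RCLike.re (inner ℂ v (T v)) ≤ hT.eigenvalues hn i * ‖v‖ ^ 2 := by
    rw [inner_apply_self_eq_sum hn hT, ← (hT.eigenvectorBasis hn).sum_sq_norm_inner_right,
      Finset.mul_sum]
    refine Finset.sum_le_sum fun k _ => ?_
    by_cases hk : i ≤ k
    · exact mul_le_mul_of_nonneg_right (hT.eigenvalues_antitone hn hk) (by positivity)
    · simp [inner_eq_zero_of_mem_span_image _ hvT (i := k) (by simpa using hk)]
  rw [hST] at hlow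
  exact le_of_mul_le_mul_right (hlow.trans hupp) (by positivity)

theorem Matrix.IsHermitian.eigenvalues₀_le_of_rank_sub {n : Type*} [Fintype n] [DecidableEq n]
    {A B : Matrix n n ℂ} (hA : A.IsHermitian) (hB : B.IsHermitian) {i j : Fin (Fintype.card n)}
    (hij : i + (A - B).rank ≤ j) : hA.eigenvalues₀ j ≤ hB.eigenvalues₀ i := by
  refine LinearMap.IsSymmetric.eigenvalues_le_of_finrank_range_sub _ _ _ ?_
  rw [Matrix.rank_eq_finrank_range_toLin _ (EuclideanSpace.basisFun n ℂ).toBasis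
    (EuclideanSpace.basisFun n ℂ).toBasis, map_sub] at hij
  exact hij

theorem Matrix.rank_sub_comm {m n K : Type*} [Fintype n] [Field K] (A B : Matrix m n K) :
    (A - B).rank = (B - A).rank := by
  have h := Matrix.rank_smul_of_mem_nonZeroDivisors (c := (-1 : K)) (B - A) (by simp)
  rwa [neg_one_smul, neg_sub] at h

theorem Matrix.rank_add_le {m n K : Type*} [Fintype n] [Finite m] [Field K] (A B : Matrix m n K) :
    (A + B).rank ≤ A.rank + B.rank := by
  have := Fintype.ofFinite m
  have h : LinearMap.range (A + B).mulVecLin ≤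
      LinearMap.range A.mulVecLin ⊔ LinearMap.range B.mulVecLin := by
    rw [Matrix.mulVecLin_add]
    exact LinearMap.range_add_le _ _
  exact (Submodule.finrank_mono h).trans (Submodule.finrank_add_le_finrank_add_finrank _ _)

theorem exists_rank_ncEval_sub_le (p : FreeAlgebra ℂ (Fin 2)) :
    ∃ C : ℕ, ∀ (N : ℕ) (A B B' : Matrix (Fin N) (Fin N) ℂ),
      (ncEval p A B - ncEval p A B').rank ≤ C * (B - B').rank := by
  unfold ncEval
  induction p with
  | grade0 r => exact ⟨0, fun N A B B' => by simp⟩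
  | grade1 i =>
    refine ⟨1, fun N A B B' => ?_⟩
    fin_cases i <;> simp
  | mul a b ha hb =>
    obtain ⟨C, hC⟩ := ha
    obtain ⟨D, hD⟩ := hb
    refine ⟨C + D, fun N A B B' => ?_⟩
    have h : ∀ a a' b b' : Matrix (Fin N) (Fin N) ℂ,
        a * b - a' * b' = (a - a') * b + a' * (b - b') := by
      intros
      noncomm_ring
    rw [map_mul, map_mul, h, add_mul]
    exact (Matrix.rank_add_le _ _).trans (add_le_add
      ((Matrix.rank_mul_le_left _ _).trans (hC N A B B'))
      ((Matrix.rank_mul_le_right _ _).trans (hD N A B B')))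
  | add a b ha hb =>
    obtain ⟨C, hC⟩ := ha
    obtain ⟨D, hD⟩ := hb
    refine ⟨C + D, fun N A B B' => ?_⟩
    rw [map_add, map_add, add_sub_add_comm, add_mul]
    exact (Matrix.rank_add_le _ _).trans (add_le_add (hC N A B B') (hD N A B B'))

theorem sum_measureReal_le_of_shift_le {Ω : Type*} [MeasurableSpace Ω] (P : Measure Ω)
    [IsProbabilityMeasure P] {n r : ℕ} (a b : Ω → Fin n → ℝ) (S : Set Ω)
    (h : ∀ ω ∉ S, ∀ i j : Fin n, (i : ℕ) + r ≤ j → b ω j ≤ a ω i) (x : ℝ) :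
    ∑ i, P.real {ω | a ω i ≤ x} ≤ ∑ i, P.real {ω | b ω i ≤ x} + r + n * P.real S := by
  set G : ℕ → ℝ := fun k => if hk : k < n then P.real {ω | b ω ⟨k, hk⟩ ≤ x} else 1 with hG
  have hG0 : ∀ k, 0 ≤ G k := fun k => by
    simp only [hG]
    split_ifs <;> positivity
  have hle : ∀ i : Fin n, P.real {ω | a ω i ≤ x} ≤ G (r + i) + P.real S := by
    intro i
    by_cases hi : r + (i : ℕ) < n
    · simp only [hG, dif_pos hi]
      refine (measureReal_mono fun ω hω => ?_).trans (measureReal_union_le _ _)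
      by_cases hS : ω ∈ S
      · exact Or.inr hS
      · exact Or.inl ((h ω hS i ⟨r + i, hi⟩ (add_comm _ _).le).trans hω)
    · simp only [hG, dif_neg hi]
      exact measureReal_le_one.trans (le_add_of_nonneg_right measureReal_nonneg)
  have hshift : ∑ i : Fin n, G (r + i) ≤ ∑ i, P.real {ω | b ω i ≤ x} + r := by
    have h₁ : ∑ i : Fin n, P.real {ω | b ω i ≤ x} = ∑ k ∈ Finset.range n, G k := by
      rw [← Fin.sum_univ_eq_sum_range]
      simp [hG]
    have h₂ : ∑ k ∈ Finset.range r, G (n + k) = r := by simp [hG]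
    rw [Fin.sum_univ_eq_sum_range (fun k => G (r + k)), h₁]
    conv_rhs => rw [← h₂]
    rw [← Finset.sum_range_add, add_comm n r, Finset.sum_range_add]
    exact le_add_of_nonneg_left (Finset.sum_nonneg fun k _ => hG0 k)
  calc ∑ i, P.real {ω | a ω i ≤ x} ≤ ∑ i : Fin n, (G (r + i) + P.real S) :=
        Finset.sum_le_sum fun i _ => hle i
    _ = ∑ i : Fin n, G (r + i) + n * P.real S := by simp [Finset.sum_add_distrib]
    _ ≤ _ := by gcongr

theorem Matrix.IsHermitian.sum_eigenvalues_comp {n M : Type*} [Fintype n] [DecidableEq n]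
    [AddCommMonoid M] {Ω : Type*} {A : Ω → Matrix n n ℂ} (hA : ∀ ω, (A ω).IsHermitian)
    (f : (Ω → ℝ) → M) :
    ∑ i, f (fun ω => (hA ω).eigenvalues i) = ∑ i, f (fun ω => (hA ω).eigenvalues₀ i) :=
  Equiv.sum_comp (Fintype.equivOfCardEq (Fintype.card_fin _)).symm
    (fun i => f (fun ω => (hA ω).eigenvalues₀ i))

theorem sum_measureReal_eigenvalues_le {Ω : Type*} [MeasurableSpace Ω] (P : Measure Ω)
    [IsProbabilityMeasure P] {n : Type*} [Fintype n] [DecidableEq n] {A B : Ω → Matrix n n ℂ}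
    (hA : ∀ ω, (A ω).IsHermitian) (hB : ∀ ω, (B ω).IsHermitian) (r : ℕ) (x : ℝ) :
    ∑ i, P.real {ω | (hA ω).eigenvalues i ≤ x} ≤
      ∑ i, P.real {ω | (hB ω).eigenvalues i ≤ x} + r +
        Fintype.card n * P.real {ω | r < (A ω - B ω).rank} := by
  rw [Matrix.IsHermitian.sum_eigenvalues_comp hA (fun g => P.real {ω | g ω ≤ x}),
    Matrix.IsHermitian.sum_eigenvalues_comp hB (fun g => P.real {ω | g ω ≤ x})]
  refine sum_measureReal_le_of_shift_le P (fun ω => (hA ω).eigenvalues₀)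
    (fun ω => (hB ω).eigenvalues₀) _ (fun ω hω i j hij => ?_) x
  refine (hB ω).eigenvalues₀_le_of_rank_sub (hA ω) ?_
  have hω' : (A ω - B ω).rank ≤ r := by simpa using hω
  rw [Matrix.rank_sub_comm]
  omega

theorem abs_eesd_sub_le {Ω : Type*} [MeasurableSpace Ω] (P : Measure Ω)
    [IsProbabilityMeasure P] {N : ℕ} {A B : Ω → Matrix (Fin N) (Fin N) ℂ}
    (hA : ∀ ω, (A ω).IsHermitian) (hB : ∀ ω, (B ω).IsHermitian) {ε : ℝ} (hε : 0 ≤ ε) (x : ℝ) :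
    |(N : ℝ)⁻¹ * ∑ i, P.real {ω | (hA ω).eigenvalues i ≤ x} -
      (N : ℝ)⁻¹ * ∑ i, P.real {ω | (hB ω).eigenvalues i ≤ x}| ≤
      ε + P.real {ω | ε ≤ ((A ω - B ω).rank : ℝ) / N} := by
  rcases N.eq_zero_or_pos with rfl | hN
  · simpa using add_nonneg hε measureReal_nonneg
  have hN' : (0 : ℝ) < N := by exact_mod_cast hN
  have hset : {ω | ⌊ε * N⌋₊ < (A ω - B ω).rank} ⊆ {ω | ε ≤ ((A ω - B ω).rank : ℝ) / N} := by
    intro ω hω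
    rw [Set.mem_ofPred_eq, le_div_iff₀ hN']
    exact ((Nat.floor_lt (by positivity)).mp hω).le
  have hS := measureReal_mono (μ := P) hset
  have hfloor : (⌊ε * N⌋₊ : ℝ) ≤ ε * N := Nat.floor_le (by positivity)
  have h₁ := sum_measureReal_eigenvalues_le P hA hB ⌊ε * N⌋₊ x
  have h₂ := sum_measureReal_eigenvalues_le P hB hA ⌊ε * N⌋₊ x
  have hsymm : {ω | ⌊ε * N⌋₊ < (B ω - A ω).rank} = {ω | ⌊ε * N⌋₊ < (A ω - B ω).rank} := by
    ext ω
    rw [Set.mem_ofPred_eq, Set.mem_ofPred_eq, Matrix.rank_sub_comm]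
  rw [hsymm] at h₂
  rw [Fintype.card_fin] at h₁ h₂
  have hNS := mul_le_mul_of_nonneg_left hS hN'.le
  rw [← mul_sub, abs_mul, abs_of_pos (inv_pos.mpr hN'), inv_mul_le_iff₀ hN', abs_le]
  constructor <;> linarith

theorem integral_le_add_measureReal {Ω : Type*} [MeasurableSpace Ω] (P : Measure Ω)
    [IsProbabilityMeasure P] {f : Ω → ℝ} (hf₀ : ∀ ω, 0 ≤ f ω) (hf₁ : ∀ ω, f ω ≤ 1) {ε : ℝ}
    (hε : 0 ≤ ε) : ∫ ω, f ω ∂P ≤ ε + P.real {ω | ε ≤ f ω} := by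
  set S := toMeasurable P {ω | ε ≤ f ω} with hS
  have hSm : MeasurableSet S := measurableSet_toMeasurable _ _
  have hint : Integrable (S.indicator fun _ => (1 : ℝ)) P := (integrable_const 1).indicator hSm
  calc ∫ ω, f ω ∂P ≤ ∫ ω, (ε + S.indicator (fun _ => (1 : ℝ)) ω) ∂P := by
        refine integral_mono_of_nonneg (.of_forall hf₀) ((integrable_const ε).add hint)
          (.of_forall fun ω => ?_)
        by_cases hω : ω ∈ S
        · simpa [hω] using (hf₁ ω).trans (le_add_of_nonneg_left hε)
        · have : ¬ ε ≤ f ω := fun h => hω (subset_toMeasurable _ _ h)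
          simpa [hω] using (not_le.mp this).le
    _ = ε + P.real {ω | ε ≤ f ω} := by
        rw [integral_add (integrable_const ε) hint, integral_indicator hSm]
        simp [measureReal_def, hS]

theorem tendsto_measureReal_rank_ncEval_sub {Ω : Type*} [MeasurableSpace Ω] (P : Measure Ω)
    [IsProbabilityMeasure P] (W Y Y' : (N : ℕ) → Ω → Matrix (Fin N) (Fin N) ℂ)
    (hrank : TendstoInMeasure P
      (fun (N : ℕ) ω => ((Y N ω - Y' N ω).rank : ℝ) / N) Filter.atTop (fun _ => 0))
    (p : FreeAlgebra ℂ (Fin 2)) {ε : ℝ} (hε : 0 < ε) :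
    Filter.Tendsto (fun N : ℕ => P.real {ω | ε ≤
        ((ncEval p (W N ω) (Y N ω) - ncEval p (W N ω) (Y' N ω)).rank : ℝ) / N})
      Filter.atTop (nhds 0) := by
  obtain ⟨C, hC⟩ := exists_rank_ncEval_sub_le p
  refine squeeze_zero (fun _ => measureReal_nonneg) (fun N => measureReal_mono fun ω hω => ?_)
    (tendstoInMeasure_iff_measureReal_dist.mp hrank (ε / (C + 1)) (by positivity))
  have hC' : ((ncEval p (W N ω) (Y N ω) - ncEval p (W N ω) (Y' N ω)).rank : ℝ) ≤
      C * (Y N ω - Y' N ω).rank := by exact_mod_cast hC N _ _ _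
  have hq : (0 : ℝ) ≤ ((Y N ω - Y' N ω).rank : ℝ) / N := by positivity
  rw [Set.mem_ofPred_eq, Real.dist_0_eq_abs, abs_of_nonneg hq, div_le_iff₀ (by positivity)]
  calc ε ≤ _ := hω
    _ ≤ C * (Y N ω - Y' N ω).rank / N := by gcongr
    _ ≤ ((Y N ω - Y' N ω).rank : ℝ) / N * (C + 1) := by
      rw [mul_div_assoc]
      linarith

theorem tendsto_zero_of_forall_le_add {u : ℕ → ℝ} {v : ℝ → ℕ → ℝ} (hu : ∀ N, 0 ≤ u N)
    (huv : ∀ ε > 0, ∀ N, u N ≤ ε + v ε N)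
    (hv : ∀ ε > 0, Filter.Tendsto (v ε) Filter.atTop (nhds 0)) :
    Filter.Tendsto u Filter.atTop (nhds 0) := by
  refine Metric.tendsto_nhds.mpr fun ε hε => ?_
  filter_upwards [(hv (ε / 2) (half_pos hε)).eventually_lt_const (half_pos hε)] with N hN
  rw [Real.dist_0_eq_abs, abs_of_nonneg (hu N)]
  linarith [huv (ε / 2) (half_pos hε) N]

/-- If `(1/N) rank (Y_N - Y_N') → 0` in probability, then for any fixed
non-commutative polynomial `p`, `E[(1/N) rank (p(W_N,Y_N) - p(W_N,Y_N'))] → 0`,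
and consequently the Kolmogorov distance between `EESD(p(W_N,Y_N))` and
`EESD(p(W_N,Y_N'))` tends to `0`, provided both evaluations are Hermitian. -/
theorem rank_truncation_polynomial_stability
    {Ω : Type*} [MeasurableSpace Ω] (P : Measure Ω) [IsProbabilityMeasure P]
    (W Y Y' : (N : ℕ) → Ω → Matrix (Fin N) (Fin N) ℂ)
    (hWHerm : ∀ N ω, (W N ω).IsHermitian)
    (hYHerm : ∀ N ω, (Y N ω).IsHermitian)
    (hY'Herm : ∀ N ω, (Y' N ω).IsHermitian)
    (hrank : TendstoInMeasure P
      (fun (N : ℕ) ω => ((Y N ω - Y' N ω).rank : ℝ) / N)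
      Filter.atTop (fun _ => 0))
    (p : FreeAlgebra ℂ (Fin 2))
    (hpHerm : ∀ N ω, (ncEval p (W N ω) (Y N ω)).IsHermitian)
    (hpHerm' : ∀ N ω, (ncEval p (W N ω) (Y' N ω)).IsHermitian) :
    Filter.Tendsto (fun N : ℕ =>
        ∫ ω, ((ncEval p (W N ω) (Y N ω) - ncEval p (W N ω) (Y' N ω)).rank : ℝ) / N ∂P)
      Filter.atTop (nhds 0) ∧
    Filter.Tendsto (fun N : ℕ =>
        ⨆ x : ℝ,
          |(N : ℝ)⁻¹ * ∑ i : Fin N, (P {ω | (hpHerm N ω).eigenvalues i ≤ x}).toReal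
            - (N : ℝ)⁻¹ * ∑ i : Fin N, (P {ω | (hpHerm' N ω).eigenvalues i ≤ x}).toReal|)
      Filter.atTop (nhds 0) := by
  have hlim := fun (ε : ℝ) (hε : ε > 0) =>
    tendsto_measureReal_rank_ncEval_sub P W Y Y' hrank p hε
  constructor
  · refine tendsto_zero_of_forall_le_add (fun N => integral_nonneg fun ω => by positivity)
      (fun ε hε N => integral_le_add_measureReal P (fun ω => by positivity) (fun ω => ?_) hε.le)
      hlim
    exact div_le_one_of_le₀ (by exact_mod_cast Matrix.rank_le_width _) (by positivity)
  · refine tendsto_zero_of_forall_le_add (fun N => Real.iSup_nonneg fun x => abs_nonneg _)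
      (fun ε hε N => Real.iSup_le (fun x => ?_) (by positivity)) hlim
    exact abs_eesd_sub_le P (hpHerm N) (hpHerm' N) hε.le x
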